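/- Every numerical monoid Γ with embedding dimension 6 and multiplicity 12 satisfies ρ(Γ) < 19. (Since 𝒞(5,12) = 19, this says 𝒭(5,12) < 𝒞(5,12).) -/

import Mathlib

open scoped Pointwise

open scoped Pointwise

/-- A numerical monoid: an additive submonoid of ℕ with finite complement. -/
def IsNumericalMonoid (Γ : AddSubmonoid ℕ) : Prop :=
  ((Γ : Set ℕ)ᶜ).Finite

/-- The (unique) minimal generating set of a submonoid of ℕ: the nonzero elements
that are not sums of two nonzero elements. -/
def minGens (Γ : AddSubmonoid ℕ) : Set ℕ :=
  {g | g ∈ Γ ∧ g ≠ 0 ∧ ∀ a ∈ Γ, ∀ b ∈ Γ, a ≠ 0 → b ≠ 0 → g ≠ a + b}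

/-- Embedding dimension: the number of minimal generators. -/
noncomputable def edim (Γ : AddSubmonoid ℕ) : ℕ :=
  (minGens Γ).ncard

/-- Multiplicity: the smallest nonzero element. -/
noncomputable def mult (Γ : AddSubmonoid ℕ) : ℕ :=
  sInf {g : ℕ | g ∈ Γ ∧ g ≠ 0}

/-- The factorization homomorphism φ, sending a formal ℕ-combination of the minimal
generators to its value in ℕ. -/
noncomputable def factorizationHom (Γ : AddSubmonoid ℕ) : (minGens Γ →₀ ℕ) →+ ℕ :=
  Finsupp.liftAddHom fun g => AddMonoidHom.mulLeft (g : ℕ)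

/-- The number of minimal relations ρ(Γ): the least cardinality of a set of pairs
generating the kernel congruence of the factorization homomorphism. -/
noncomputable def rho (Γ : AddSubmonoid ℕ) : ℕ :=
  sInf {n : ℕ | ∃ R : Set ((minGens Γ →₀ ℕ) × (minGens Γ →₀ ℕ)),
    R.Finite ∧ R.ncard = n ∧
    addConGen (fun a b => (a, b) ∈ R) = AddCon.ker (factorizationHom Γ)}

/-- Pseudo-Frobenius numbers of Γ. -/
def pseudoFrobenius (Γ : AddSubmonoid ℕ) : Set ℕ :=
  {p | p ∉ Γ ∧ ∀ g ∈ Γ, g ≠ 0 → p + g ∈ Γ}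

/-- The type of Γ: the number of pseudo-Frobenius numbers. -/
noncomputable def numType (Γ : AddSubmonoid ℕ) : ℕ :=
  (pseudoFrobenius Γ).ncard

/-- The Apéry set of Γ with respect to its multiplicity. -/
def aperySet (Γ : AddSubmonoid ℕ) : Set ℕ :=
  {g | g ∈ Γ ∧ ¬ ∃ γ ∈ Γ, g = γ + mult Γ}

/-- The Macaulay upper function: if `n = C(n_d,d) + ⋯ + C(n_j,j)` is the Macaulay
expansion of `n`, then `macUpper d n = C(n_d+1,d+1) + ⋯ + C(n_j+1,j+1)`, i.e. `n^⟨d⟩`. -/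
noncomputable def macUpper : ℕ → ℕ → ℕ
  | 0, _ => 0
  | d + 1, n =>
    if n = 0 then 0
    else
      Nat.choose (sSup {a : ℕ | Nat.choose a (d + 1) ≤ n} + 1) (d + 2) +
        macUpper d (n - Nat.choose (sSup {a : ℕ | Nat.choose a (d + 1) ≤ n}) (d + 1))

/-- The Macaulay lower function: if `n = C(n_d,d) + ⋯ + C(n_j,j)` is the Macaulay
expansion of `n`, then `macLower d n = C(n_d-1,d) + ⋯ + C(n_j-1,j)`, i.e. `n_⟨d⟩`. -/
noncomputable def macLower : ℕ → ℕ → ℕ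
  | 0, _ => 0
  | d + 1, n =>
    if n = 0 then 0
    else
      Nat.choose (sSup {a : ℕ | Nat.choose a (d + 1) ≤ n} - 1) (d + 1) +
        macLower d (n - Nat.choose (sSup {a : ℕ | Nat.choose a (d + 1) ≤ n}) (d + 1))

/-- The unique positive `r` with `C(e+r-1,r-1) ≤ m < C(e+r,r)`. -/
noncomputable def macR (e m : ℕ) : ℕ :=
  sInf {r : ℕ | 0 < r ∧ m < Nat.choose (e + r) r}

/-- The bound 𝒞(e,m) = C(e+r-1,r) + s^⟨r⟩ - s, where s = m - C(e+r-1,r-1). -/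
noncomputable def mathcalC (e m : ℕ) : ℕ :=
  Nat.choose (e + macR e m - 1) (macR e m) +
      macUpper (macR e m) (m - Nat.choose (e + macR e m - 1) (macR e m - 1)) -
    (m - Nat.choose (e + macR e m - 1) (macR e m - 1))

/-- The bound 𝒟(e,m) = C(e+r-2,r-1) + s_⟨r⟩, where s = m - C(e+r-1,r-1). -/
noncomputable def mathcalD (e m : ℕ) : ℕ :=
  Nat.choose (e + macR e m - 2) (macR e m - 1) +
    macLower (macR e m) (m - Nat.choose (e + macR e m - 1) (macR e m - 1))


/-- The number of pairs `i ≤ j` marked by `B`. -/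
def pairCount (B : Fin 5 → Fin 5 → Bool) : ℕ :=
  ∑ i, ∑ j, if i ≤ j then (B i j).toNat else 0

/-- The number of triples `i ≤ j ≤ k` all of whose pairs are marked by `B`. -/
def tripleCount (B : Fin 5 → Fin 5 → Bool) : ℕ :=
  ∑ i, ∑ j, ∑ k, if i ≤ j ∧ j ≤ k then (B i j && (B i k && B j k)).toNat else 0

/-- `B` marks all pairs `i ≤ j` with both entries in some fixed set of size three. -/
def HasFullTriple (B : Fin 5 → Fin 5 → Bool) : Prop :=
  ∃ i j k : Fin 5, i < j ∧ j < k ∧ B i i = true ∧ B i j = true ∧ B i k = true ∧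
    B j j = true ∧ B j k = true ∧ B k k = true

theorem tripleCount_le_aux : ∀ b00 b01 b02 b03 b04 b11 b12 b13 b14 b22 b23 b24 b33 b34 b44 : Bool,
    Nat.ble (
    b00.toNat + b01.toNat + b02.toNat + b03.toNat + b04.toNat + b11.toNat + b12.toNat +
    b13.toNat + b14.toNat + b22.toNat + b23.toNat + b24.toNat + b33.toNat + b34.toNat +
    b44.toNat) 6 = true →
    (Nat.ble (
    (b00).toNat + (b00 && b01).toNat + (b00 && b02).toNat + (b00 && b03).toNat +
    (b00 && b04).toNat + (b01 && b11).toNat + (b01 && b02 && b12).toNat +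
    (b01 && b03 && b13).toNat + (b01 && b04 && b14).toNat + (b02 && b22).toNat +
    (b02 && b03 && b23).toNat + (b02 && b04 && b24).toNat + (b03 && b33).toNat +
    (b03 && b04 && b34).toNat + (b04 && b44).toNat + (b11).toNat + (b11 && b12).toNat +
    (b11 && b13).toNat + (b11 && b14).toNat + (b12 && b22).toNat + (b12 && b13 && b23).toNat +
    (b12 && b14 && b24).toNat + (b13 && b33).toNat + (b13 && b14 && b34).toNat +
    (b14 && b44).toNat + (b22).toNat + (b22 && b23).toNat + (b22 && b24).toNat +
    (b23 && b33).toNat + (b23 && b24 && b34).toNat + (b24 && b44).toNat + (b33).toNat +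
    (b33 && b34).toNat + (b34 && b44).toNat + (b44).toNat)
    ([3, 3, 2, 5, 7, 8, 9].getD (
    b00.toNat + b01.toNat + b02.toNat + b03.toNat + b04.toNat + b11.toNat + b12.toNat +
    b13.toNat + b14.toNat + b22.toNat + b23.toNat + b24.toNat + b33.toNat + b34.toNat +
    b44.toNat) 0) ||
    (b00 && b01 && b02 && b11 && b12 && b22) || (b00 && b01 && b03 && b11 && b13 && b33) ||
    (b00 && b01 && b04 && b11 && b14 && b44) || (b00 && b02 && b03 && b22 && b23 && b33) ||
    (b00 && b02 && b04 && b22 && b24 && b44) || (b00 && b03 && b04 && b33 && b34 && b44) ||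
    (b11 && b12 && b13 && b22 && b23 && b33) || (b11 && b12 && b14 && b22 && b24 && b44) ||
    (b11 && b13 && b14 && b33 && b34 && b44) || (b22 && b23 && b24 && b33 && b34 && b44)) =
      true := by
  decide +kernel

/-- At most six marked pairs span few fully marked triples, unless all pairs inside a set of size
three are marked. -/
theorem tripleCount_le (B : Fin 5 → Fin 5 → Bool) (hB : pairCount B ≤ 6) :
    tripleCount B ≤ [3, 3, 2, 5, 7, 8, 9].getD (pairCount B) 0 ∨ HasFullTriple B := by
  have key := tripleCount_le_aux (B 0 0) (B 0 1) (B 0 2) (B 0 3) (B 0 4) (B 1 1) (B 1 2) (B 1 3)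
      (B 1 4) (B 2 2) (B 2 3) (B 2 4) (B 3 3) (B 3 4) (B 4 4)
  have hq : pairCount B =
    (B 0 0).toNat + (B 0 1).toNat + (B 0 2).toNat + (B 0 3).toNat + (B 0 4).toNat + (B 1 1).toNat +
    (B 1 2).toNat +
    (B 1 3).toNat + (B 1 4).toNat + (B 2 2).toNat + (B 2 3).toNat + (B 2 4).toNat + (B 3 3).toNat +
    (B 3 4).toNat +
    (B 4 4).toNat := by
    simp [pairCount, Fin.sum_univ_five, ← add_assoc]
  have ht : tripleCount B =
    (B 0 0).toNat + (B 0 0 && B 0 1).toNat + (B 0 0 && B 0 2).toNat + (B 0 0 && B 0 3).toNat +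
    (B 0 0 && B 0 4).toNat + (B 0 1 && B 1 1).toNat + (B 0 1 && B 0 2 && B 1 2).toNat +
    (B 0 1 && B 0 3 && B 1 3).toNat + (B 0 1 && B 0 4 && B 1 4).toNat + (B 0 2 && B 2 2).toNat +
    (B 0 2 && B 0 3 && B 2 3).toNat + (B 0 2 && B 0 4 && B 2 4).toNat + (B 0 3 && B 3 3).toNat +
    (B 0 3 && B 0 4 && B 3 4).toNat + (B 0 4 && B 4 4).toNat + (B 1 1).toNat +
    (B 1 1 && B 1 2).toNat +
    (B 1 1 && B 1 3).toNat + (B 1 1 && B 1 4).toNat + (B 1 2 && B 2 2).toNat +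
    (B 1 2 && B 1 3 && B 2 3).toNat +
    (B 1 2 && B 1 4 && B 2 4).toNat + (B 1 3 && B 3 3).toNat + (B 1 3 && B 1 4 && B 3 4).toNat +
    (B 1 4 && B 4 4).toNat + (B 2 2).toNat + (B 2 2 && B 2 3).toNat + (B 2 2 && B 2 4).toNat +
    (B 2 3 && B 3 3).toNat + (B 2 3 && B 2 4 && B 3 4).toNat + (B 2 4 && B 4 4).toNat +
    (B 3 3).toNat +
    (B 3 3 && B 3 4).toNat + (B 3 4 && B 4 4).toNat + (B 4 4).toNat := by
    simp [tripleCount, Fin.sum_univ_five, ← add_assoc, Bool.and_assoc]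
  rw [← hq, ← ht] at key
  simp only [Nat.ble_eq, Bool.or_eq_true, Bool.and_eq_true] at key
  rcases key hB with (((((((((h | h) | h) | h) | h) | h) | h) | h) | h) | h) | h
  · exact Or.inl h
  all_goals
    obtain ⟨⟨⟨⟨⟨h₁, h₂⟩, h₃⟩, h₄⟩, h₅⟩, h₆⟩ := h
    exact Or.inr ⟨_, _, _, by decide, by decide, h₁, h₂, h₃, h₄, h₅, h₆⟩

section Monomials

variable {ι : Type*} [DecidableEq ι]

/-- The exponent vectors supported on a single variable. -/
def IsPurePower (v : ι → ℕ) : Prop :=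
  ∃ i n, v = Pi.single i n

theorem exists_add_single {u : ι → ℕ} (hu : u ≠ 0) : ∃ i, ∃ v : ι → ℕ, u = v + Pi.single i 1 := by
  obtain ⟨i, hi⟩ := Function.ne_iff.1 hu
  refine ⟨i, u - Pi.single i 1, (tsub_add_cancel_of_le ?_).symm⟩
  intro j
  by_cases h : j = i
  · subst h; simpa [Nat.one_le_iff_ne_zero] using hi
  · simp [h]

theorem exists_add_single_add_single {u : ι → ℕ} (h0 : u ≠ 0) (hu : ¬ IsPurePower u) :
    ∃ i j, ∃ c : ι → ℕ, i ≠ j ∧ u = c + Pi.single i 1 + Pi.single j 1 := by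
  obtain ⟨i, v, rfl⟩ := exists_add_single h0
  have : ∃ j, j ≠ i ∧ v j ≠ 0 := by
    by_contra! h
    refine hu ⟨i, v i + 1, ?_⟩
    ext j
    by_cases hj : j = i
    · subst hj; simp
    · simp [hj, h j hj]
  obtain ⟨j, hji, hj⟩ := this
  refine ⟨i, j, v - Pi.single j 1, hji.symm, ?_⟩
  rw [add_right_comm, tsub_add_cancel_of_le]
  intro k
  by_cases h : k = j
  · subst h; simpa [Nat.one_le_iff_ne_zero] using hj
  · simp [h]

theorem sup_add_single {c : ι → ℕ} {i j : ι} (hij : i ≠ j) :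
    (c + Pi.single i 1) ⊔ (c + Pi.single j 1) = c + Pi.single i 1 + Pi.single j 1 := by
  ext k
  by_cases hi : k = i
  · subst hi; simp [hij]
  · by_cases hj : k = j
    · subst hj; simp [hi]
    · simp [hi, hj]

theorem eq_zero_of_isPurePower_add_single {c : ι → ℕ} {i j : ι} (hij : i ≠ j)
    (hi : IsPurePower (c + Pi.single i 1)) (hj : IsPurePower (c + Pi.single j 1)) : c = 0 := by
  have key : ∀ {i k : ι}, IsPurePower (c + Pi.single i 1) → k ≠ i → c k = 0 := by
    rintro i k ⟨t, n, h⟩ hk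
    have h1 := congrFun h i
    have h2 := congrFun h k
    by_cases hit : i = t
    · subst hit; simpa [hk] using h2
    · simp [hit] at h1
  ext k
  by_cases hk : k = i
  · exact key hj (hk ▸ hij)
  · exact key hi hk

open Classical in
/-- A bound for the number of monomials of degree at least three all of whose maximal proper
divisors lie in `S`. -/
theorem card_le_of_divisors_mem [Fintype ι] (S U : Finset (ι → ℕ)) (hdeg : ∀ u ∈ U, 3 ≤ ∑ i, u i)
    (hU : ∀ u ∈ U, ∀ i v, u = v + Pi.single i 1 → v ∈ S) :
    U.card ≤ (S.filter IsPurePower).card +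
      (S.card.choose 2 - (S.filter IsPurePower).card.choose 2) := by
  rw [← Finset.card_filter_add_card_filter_not (s := U) IsPurePower]
  refine add_le_add ?_ ?_
  · refine Finset.card_le_card_of_injOn (fun u i => u i - 1) ?_ ?_
    · intro u hu
      simp only [Finset.coe_filter, Set.mem_ofPred_eq] at hu ⊢
      obtain ⟨hu, i, n, rfl⟩ := hu
      have hn : 3 ≤ n := by simpa using hdeg _ hu
      have hpred : (fun k => (Pi.single i n : ι → ℕ) k - 1) = Pi.single i (n - 1) := by
        ext k
        by_cases hk : k = i
        · subst hk; simp
        · simp [hk]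
      rw [hpred]
      refine ⟨hU _ hu i _ ?_, i, n - 1, rfl⟩
      rw [← Pi.single_add, Nat.sub_add_cancel (by omega)]
    · intro u hu v hv h
      simp only [Finset.coe_filter, Set.mem_ofPred_eq] at hu hv
      obtain ⟨hu, i, n, rfl⟩ := hu
      obtain ⟨hv, j, m, rfl⟩ := hv
      have hn : 3 ≤ n := by simpa using hdeg _ hu
      have hm : 3 ≤ m := by simpa using hdeg _ hv
      have h1 := congrFun h i
      by_cases hij : i = j
      · subst hij
        simp at h1
        rw [show n = m by omega]
      · simp [hij] at h1
        omega
  · have hP : (S.filter IsPurePower).powersetCard 2 ⊆ S.powersetCard 2 :=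
      Finset.powersetCard_mono (Finset.filter_subset _ _)
    rw [← Finset.card_powersetCard, ← Finset.card_powersetCard, ← Finset.card_sdiff_of_subset hP]
    have hex : ∀ u : ι → ℕ, ∃ p : (ι → ℕ) × (ι → ℕ), u ∈ U.filter (fun u => ¬ IsPurePower u) →
        p.1 ∈ S ∧ p.2 ∈ S ∧ p.1 ≠ p.2 ∧ ¬ (IsPurePower p.1 ∧ IsPurePower p.2) ∧
          p.1 ⊔ p.2 = u := by
      intro u
      by_cases hu : u ∈ U.filter (fun u => ¬ IsPurePower u)
      · obtain ⟨huU, hup⟩ := Finset.mem_filter.1 hu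
        have hu0 : u ≠ 0 := by
          rintro rfl
          simpa using hdeg _ huU
        obtain ⟨i, j, c, hij, rfl⟩ := exists_add_single_add_single hu0 hup
        refine ⟨(c + Pi.single i 1, c + Pi.single j 1), fun _ =>
          ⟨hU _ huU j _ rfl, hU _ huU i _ (add_right_comm _ _ _), ?_, ?_, sup_add_single hij⟩⟩
        · intro h
          have := congrFun (add_left_cancel h) i
          simp [hij] at this
        · rintro ⟨h1, h2⟩
          have := hdeg _ huU
          simp [eq_zero_of_isPurePower_add_single hij h1 h2, Finset.sum_add_distrib] at this
      · exact ⟨(0, 0), fun h => (hu h).elim⟩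
    choose p hp using hex
    refine Finset.card_le_card_of_injOn (fun u => {(p u).1, (p u).2}) ?_ ?_
    · intro u hu
      obtain ⟨h1, h2, h3, h4, -⟩ := hp u hu
      simp only [Finset.coe_sdiff, Set.mem_sdiff, Finset.mem_coe, Finset.mem_powersetCard,
        Finset.insert_subset_iff, Finset.singleton_subset_iff, Finset.mem_filter]
      refine ⟨⟨⟨h1, h2⟩, Finset.card_pair h3⟩, fun h => h4 ⟨h.1.1.2, h.1.2.2⟩⟩
    · intro u hu v hv h
      obtain ⟨-, -, -, -, h1⟩ := hp u hu
      obtain ⟨-, -, -, -, h2⟩ := hp v hv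
      rw [← h1, ← h2]
      have := congrArg (fun s : Finset (ι → ℕ) => s.sup id) h
      simpa using this

end Monomials
section Rewriting

variable {A L : Type*} [AddCommMonoid A] [AddCommMonoid L] [LinearOrder L]

/-- Elements whose key is least in their residue class of weights modulo `m`. -/
def IsLeastInResidueClass (m : ℕ) (w : A →+ ℕ) (κ : A →+ L) (a : A) : Prop :=
  ∀ b, w b ≡ w a [MOD m] → κ a ≤ κ b

variable {m : ℕ} {w : A →+ ℕ} {κ : A →+ L}

theorem exists_isLeastInResidueClass [WellFoundedLT L] (m : ℕ) (w : A →+ ℕ) (κ : A →+ L) (a : A) :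
    ∃ r, IsLeastInResidueClass m w κ r ∧ w r ≡ w a [MOD m] := by
  obtain ⟨r, hr, hmin⟩ := (InvImage.wf κ (wellFounded_lt (α := L))).has_min
    {b | w b ≡ w a [MOD m]} ⟨a, Nat.ModEq.refl _⟩
  exact ⟨r, fun b hb => not_lt.1 (hmin b (hb.trans hr)), hr⟩

theorem IsLeastInResidueClass.of_add [IsOrderedCancelAddMonoid L] {a b : A}
    (h : IsLeastInResidueClass m w κ (a + b)) : IsLeastInResidueClass m w κ a := by
  intro c hc
  have h1 := h (c + b) (by simpa using hc.add_right _)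
  simpa using h1

theorem IsLeastInResidueClass.eq_of_modEq (hκ : Function.Injective κ) {a b : A}
    (ha : IsLeastInResidueClass m w κ a)
    (hb : IsLeastInResidueClass m w κ b) (h : w a ≡ w b [MOD m]) : a = b :=
  hκ (le_antisymm (ha b h.symm) (hb a h))

/-- The kernel congruence of `φ` is generated by rewriting each corner of the set of reduced
elements to its reduced representative. -/
theorem exists_generating_pairs [IsOrderedCancelAddMonoid L] [WellFoundedLT L]
    {X : Type*} [AddCommMonoid X] (φ : X →+ ℕ) (t : X) (ι : A →+ X)
    (hsurj : ∀ x, ∃ k : ℕ, ∃ a, x = k • t + ι a) (hm : 0 < m) (hφt : φ t = m)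
    (hw : ∀ a, φ (ι a) = w a) (hκ : Function.Injective κ)
    (hκw : ∀ a b, κ a ≤ κ b → w a ≤ w b)
    (K : Set A) (hK : ∀ a, ¬ IsLeastInResidueClass m w κ a →
      ∃ u ∈ K, ¬ IsLeastInResidueClass m w κ u ∧ ∃ c, a = u + c) :
    ∃ f : A → X × X, addConGen (fun x y => (x, y) ∈ f '' K) = AddCon.ker φ := by
  choose red hred hmod using exists_isLeastInResidueClass m w κ
  have hle : ∀ a, w (red a) ≤ w a := fun a => hκw _ _ (hred a a (hmod a).symm)
  have hdiv : ∀ a, w a = (w a - w (red a)) / m * m + w (red a) := fun a => by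
    have h1 : m ∣ w a - w (red a) := (Nat.modEq_iff_dvd' (hle a)).1 (hmod a)
    rw [Nat.div_mul_cancel h1, Nat.sub_add_cancel (hle a)]
  set q : A → ℕ := fun a => (w a - w (red a)) / m with hq
  let f : A → X × X := fun a => (ι a, q a • t + ι (red a))
  refine ⟨f, ?_⟩
  set C := addConGen (fun x y => (x, y) ∈ f '' K) with hC
  have hCle : C ≤ AddCon.ker φ := by
    refine AddCon.addConGen_le.2 ?_
    rintro x y ⟨a, -, hxy⟩
    simp only [f, Prod.mk.injEq] at hxy
    rw [AddCon.ker_rel, ← hxy.1, ← hxy.2, map_add, map_nsmul, hφt, hw, hw, smul_eq_mul]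
    exact hdiv a
  have hCK : ∀ u ∈ K, C (ι u) (q u • t + ι (red u)) := fun u hu =>
    AddConGen.Rel.of _ _ ⟨u, hu, rfl⟩
  have main : ∀ a, ∃ k : ℕ, C (ι a) (k • t + ι (red a)) := by
    intro a
    induction a using (InvImage.wf κ (wellFounded_lt (α := L))).induction with
    | _ a ih =>
      by_cases ha : IsLeastInResidueClass m w κ a
      · refine ⟨0, ?_⟩
        rw [(hred a).eq_of_modEq hκ ha (hmod a), zero_smul, zero_add]
        exact C.refl _
      · obtain ⟨u, hu, hun, c, rfl⟩ := hK a ha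
        have hlt : κ (red u) < κ u := by
          refine lt_of_le_of_ne (hred u u (hmod u).symm) fun h => hun ?_
          rw [← hκ h]; exact hred u
        obtain ⟨k, hk⟩ := ih (red u + c) (by
          simp only [InvImage, map_add]
          exact add_lt_add_left hlt _)
        have hr : red (red u + c) = red (u + c) := by
          refine (hred _).eq_of_modEq hκ (hred _) ?_
          refine (hmod _).trans (Nat.ModEq.trans ?_ (hmod _).symm)
          simpa using (hmod u).add_right (w c)
        rw [hr] at hk
        refine ⟨q u + k, ?_⟩
        have h1 := C.add (hCK u hu) (C.refl (ι c))
        have h2 := C.add (C.refl (q u • t)) hk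
        rw [← map_add] at h1
        rw [add_assoc, ← map_add] at h1
        rw [add_smul, add_assoc]
        exact C.trans h1 h2
  refine le_antisymm hCle fun x y hxy => ?_
  rw [AddCon.ker_rel] at hxy
  have norm : ∀ x, ∃ k : ℕ, ∃ r, IsLeastInResidueClass m w κ r ∧ C x (k • t + ι r) := by
    intro x
    obtain ⟨k, a, rfl⟩ := hsurj x
    obtain ⟨l, hl⟩ := main a
    refine ⟨k + l, red a, hred a, ?_⟩
    rw [add_smul, add_assoc]
    exact C.add (C.refl _) hl
  obtain ⟨k, r, hr, hkr⟩ := norm x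
  obtain ⟨l, s, hs, hls⟩ := norm y
  have h1 := hCle hkr
  have h2 := hCle hls
  rw [AddCon.ker_rel] at h1 h2
  simp only [map_add, map_nsmul, hφt, hw, smul_eq_mul] at h1 h2
  have h3 : k * m + w r = l * m + w s := by omega
  have hrs : r = s := by
    refine hr.eq_of_modEq hκ hs ?_
    have : (k * m + w r) % m = (l * m + w s) % m := by rw [h3]
    simpa [Nat.ModEq, Nat.add_mod] using this
  subst hrs
  have hkl : k = l := Nat.eq_of_mul_eq_mul_right hm (by omega)
  subst hkl
  exact C.trans hkr (C.symm hls)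

end Rewriting
section Corners

theorem sum_add_single (v : Fin 5 → ℕ) (i : Fin 5) :
    ∑ t, (v + Pi.single i 1 : Fin 5 → ℕ) t = ∑ t, v t + 1 := by
  simp [Finset.sum_add_distrib]

theorem eq_zero_or_eq_single_of_sum_lt_two {u : Fin 5 → ℕ} (hu : ∑ t, u t < 2) :
    u = 0 ∨ ∃ i, u = Pi.single i 1 := by
  by_cases h : u = 0
  · exact Or.inl h
  · obtain ⟨i, v, rfl⟩ := exists_add_single h
    rw [sum_add_single] at hu
    have hv : v = 0 := by
      ext t
      exact (Finset.sum_eq_zero_iff.1 (show ∑ t, v t = 0 by omega)) t (Finset.mem_univ t)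
    exact Or.inr ⟨i, by simp [hv]⟩

theorem exists_eq_add_of_sum_eq_two {u : Fin 5 → ℕ} (hu : ∑ t, u t = 2) :
    ∃ i j, i ≤ j ∧ u = Pi.single i 1 + Pi.single j 1 := by
  have h0 : u ≠ 0 := by rintro rfl; simp at hu
  obtain ⟨i, v, rfl⟩ := exists_add_single h0
  rw [sum_add_single] at hu
  obtain rfl | ⟨j, rfl⟩ := eq_zero_or_eq_single_of_sum_lt_two (u := v) (by omega)
  · simp at hu
  · rcases le_total i j with h | h
    · exact ⟨i, j, h, by abel⟩
    · exact ⟨j, i, h, by abel⟩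

theorem exists_eq_add_of_sum_eq_three {u : Fin 5 → ℕ} (hu : ∑ t, u t = 3) :
    ∃ i j k, i ≤ j ∧ j ≤ k ∧ u = Pi.single i 1 + Pi.single j 1 + Pi.single k 1 := by
  have h0 : u ≠ 0 := by rintro rfl; simp at hu
  obtain ⟨i, v, rfl⟩ := exists_add_single h0
  rw [sum_add_single] at hu
  obtain ⟨j, k, hjk, rfl⟩ := exists_eq_add_of_sum_eq_two (u := v) (by omega)
  rcases le_total i j with h | h
  · exact ⟨i, j, k, h, hjk, by abel⟩
  · rcases le_total i k with h' | h'
    · exact ⟨j, i, k, h, h', by abel⟩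
    · exact ⟨j, k, i, hjk, h', by abel⟩

variable (N : Finset (Fin 5 → ℕ))

/-- The pairs of variables whose product lies in `N`. -/
def quadrics (i j : Fin 5) : Bool :=
  decide (Pi.single i 1 + Pi.single j 1 ∈ N)

theorem pairCount_quadrics :
    pairCount (quadrics N) = (N.filter fun u => ∑ t, u t = 2).card := by
  have h1 : N.filter (fun u => ∑ t, u t = 2) =
      ((Finset.univ : Finset (Fin 5 × Fin 5)).filter
        fun p => p.1 ≤ p.2 ∧ quadrics N p.1 p.2 = true).image
          fun p => Pi.single p.1 1 + Pi.single p.2 1 := by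
    ext u
    simp only [Finset.mem_filter, Finset.mem_image, Finset.mem_univ, true_and, quadrics,
      decide_eq_true_eq]
    constructor
    · rintro ⟨hu, h2⟩
      obtain ⟨i, j, hij, rfl⟩ := exists_eq_add_of_sum_eq_two h2
      exact ⟨(i, j), ⟨hij, hu⟩, rfl⟩
    · rintro ⟨⟨i, j⟩, ⟨hij, hu⟩, rfl⟩
      exact ⟨hu, by simp [Finset.sum_add_distrib]⟩
  have hinj : ∀ i j k l : Fin 5, i ≤ j → k ≤ l → (∀ t, (Pi.single i 1 + Pi.single j 1 : Fin 5 → ℕ) t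
      = (Pi.single k 1 + Pi.single l 1 : Fin 5 → ℕ) t) → i = k ∧ j = l := by
    decide +kernel
  rw [h1, Finset.card_image_of_injOn, Finset.card_filter, Fintype.sum_prod_type, pairCount]
  · refine Finset.sum_congr rfl fun i _ => Finset.sum_congr rfl fun j _ => ?_
    by_cases h : i ≤ j <;> cases quadrics N i j <;> simp [h]
  · rintro ⟨i, j⟩ h ⟨k, l⟩ h' heq
    simp only [Finset.coe_filter, Finset.mem_univ, true_and, Set.mem_ofPred_eq] at h h'
    obtain ⟨rfl, rfl⟩ := hinj i j k l h.1 h'.1 (congrFun heq)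
    rfl

theorem card_le_tripleCount (U : Finset (Fin 5 → ℕ)) (hdeg : ∀ u ∈ U, ∑ t, u t = 3)
    (hU : ∀ u ∈ U, ∀ i v, u = v + Pi.single i 1 → v ∈ N) :
    U.card ≤ tripleCount (quadrics N) := by
  have h1 : U ⊆ ((Finset.univ : Finset (Fin 5 × Fin 5 × Fin 5)).filter
        fun p => (p.1 ≤ p.2.1 ∧ p.2.1 ≤ p.2.2) ∧
          (quadrics N p.1 p.2.1 && (quadrics N p.1 p.2.2 && quadrics N p.2.1 p.2.2)) = true).image
          fun p => Pi.single p.1 1 + Pi.single p.2.1 1 + Pi.single p.2.2 1 := by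
    intro u hu
    obtain ⟨i, j, k, hij, hjk, rfl⟩ := exists_eq_add_of_sum_eq_three (hdeg u hu)
    simp only [Finset.mem_image, Finset.mem_filter, Finset.mem_univ, true_and, quadrics,
      Bool.and_eq_true, decide_eq_true_eq]
    exact ⟨(i, j, k), ⟨⟨hij, hjk⟩, hU _ hu k _ rfl, hU _ hu j _ (by abel),
      hU _ hu i _ (by abel)⟩, rfl⟩
  refine (Finset.card_le_card h1).trans (Finset.card_image_le.trans_eq ?_)
  rw [Finset.card_filter, Fintype.sum_prod_type, tripleCount]
  refine Finset.sum_congr rfl fun i _ => ?_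
  rw [Fintype.sum_prod_type]
  refine Finset.sum_congr rfl fun j _ => Finset.sum_congr rfl fun k _ => ?_
  by_cases h : i ≤ j ∧ j ≤ k
  · cases (quadrics N i j && (quadrics N i k && quadrics N j k)) <;> simp [h]
  · simp only [h, false_and, if_false]

variable {N}

theorem two_le_card_of_not_isPurePower (hdown : ∀ a b, a + b ∈ N → a ∈ N) {u : Fin 5 → ℕ}
    (hu : u ∈ N) (hdeg : 3 ≤ ∑ t, u t) (hpure : ¬ IsPurePower u) :
    2 ≤ (N.filter fun u => ∑ t, u t = 2).card := by
  have h0 : u ≠ 0 := by rintro rfl; simp at hdeg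
  obtain ⟨i, j, c, hij, rfl⟩ := exists_add_single_add_single h0 hpure
  have hc : c ≠ 0 := by rintro rfl; simp [Finset.sum_add_distrib] at hdeg
  obtain ⟨l, d, rfl⟩ := exists_add_single hc
  have h1 : Pi.single i 1 + Pi.single l 1 ∈ N :=
    hdown _ (d + Pi.single j 1) (by convert hu using 1; abel)
  have h2 : Pi.single j 1 + Pi.single l 1 ∈ N :=
    hdown _ (d + Pi.single i 1) (by convert hu using 1; abel)
  refine Finset.one_lt_card.2 ⟨_, Finset.mem_filter.2 ⟨h1, by simp [Finset.sum_add_distrib]⟩,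
    _, Finset.mem_filter.2 ⟨h2, by simp [Finset.sum_add_distrib]⟩, fun h => ?_⟩
  have := congrFun (add_right_cancel h) i
  simp [hij] at this

theorem add_le_nine_of_le {q k p T : ℕ} (hqk : q + k = 6)
    (hT : T ≤ [3, 3, 2, 5, 7, 8, 9].getD q 0) (hpk : p ≤ k) (hp : q ≤ 1 → p = k) :
    T + (p + (k.choose 2 - p.choose 2)) ≤ 9 := by
  obtain rfl : q = 6 - k := by omega
  have hk : k ≤ 6 := by omega
  interval_cases k <;> interval_cases p <;> simp [Nat.choose] at hT hp ⊢ <;> omega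

/-- An order ideal of twelve monomials in five variables, containing all the variables but not
all quadratic monomials in some three of them, has at most eighteen corners. -/
theorem card_corners_le (hdown : ∀ a b, a + b ∈ N → a ∈ N) (hcard : N.card = 12)
    (hvar : ∀ i, Pi.single i 1 ∈ N) (hfull : ¬ HasFullTriple (quadrics N))
    (K : Finset (Fin 5 → ℕ)) (hKN : Disjoint K N)
    (hK : ∀ u ∈ K, ∀ i v, u = v + Pi.single i 1 → v ∈ N) : K.card ≤ 18 := by
  classical
  have h0 : (0 : Fin 5 → ℕ) ∈ N := hdown 0 (Pi.single 0 1) (by simpa using hvar 0)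
  have hlow : N.filter (fun u => ∑ t, u t < 2) =
      insert 0 ((Finset.univ : Finset (Fin 5)).image fun i => Pi.single i 1) := by
    ext u
    simp only [Finset.mem_filter, Finset.mem_insert, Finset.mem_image, Finset.mem_univ, true_and]
    constructor
    · rintro ⟨-, h⟩
      obtain h | ⟨i, h⟩ := eq_zero_or_eq_single_of_sum_lt_two h
      · exact Or.inl h
      · exact Or.inr ⟨i, h.symm⟩
    · rintro (rfl | ⟨i, rfl⟩)
      · exact ⟨h0, by simp⟩
      · exact ⟨hvar i, by simp⟩
  have hlowcard : (N.filter fun u => ∑ t, u t < 2).card = 6 := by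
    rw [hlow]; decide +kernel
  set M := N.filter fun u => 2 ≤ ∑ t, u t with hM
  have hMcard : M.card = 6 := by
    have h := Finset.card_filter_add_card_filter_not (s := N) (fun u => ∑ t, u t < 2)
    have hM' : M = N.filter fun u => ¬ ∑ t, u t < 2 := by
      ext u; simp only [hM, Finset.mem_filter, not_lt]
    rw [← hM'] at h
    omega
  have hKdeg : ∀ u ∈ K, 2 ≤ ∑ t, u t := by
    intro u hu
    by_contra h
    have hN : u ∉ N := Finset.disjoint_left.1 hKN hu
    obtain rfl | ⟨i, rfl⟩ := eq_zero_or_eq_single_of_sum_lt_two (not_le.1 h)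
    · exact hN h0
    · exact hN (hvar i)
  set U := K ∪ M with hUdef
  have hUcard : U.card = K.card + 6 := by
    rw [hUdef, Finset.card_union_of_disjoint, hMcard]
    exact hKN.mono_right (Finset.filter_subset _ _)
  have hUdeg : ∀ u ∈ U, 2 ≤ ∑ t, u t := by
    intro u hu
    rcases Finset.mem_union.1 hu with h | h
    · exact hKdeg u h
    · exact (Finset.mem_filter.1 h).2
  have hU : ∀ u ∈ U, ∀ i v, u = v + Pi.single i 1 → v ∈ N := by
    intro u hu i v huv
    rcases Finset.mem_union.1 hu with h | h
    · exact hK u h i v huv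
    · exact hdown v (Pi.single i 1) (huv ▸ (Finset.mem_filter.1 h).1)
  have hU2 : (U.filter fun u => ∑ t, u t = 2).card ≤ 15 := by
    refine (Finset.card_le_card (t := ((Finset.univ : Finset (Fin 5 × Fin 5)).filter
      fun p => p.1 ≤ p.2).image fun p => Pi.single p.1 1 + Pi.single p.2 1) fun u hu => ?_).trans
        (Finset.card_image_le.trans (by decide))
    obtain ⟨i, j, hij, rfl⟩ := exists_eq_add_of_sum_eq_two (Finset.mem_filter.1 hu).2
    exact Finset.mem_image.2 ⟨(i, j), by simpa using hij, rfl⟩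
  have hU3 := card_le_tripleCount N (U.filter fun u => ∑ t, u t = 3)
    (fun u hu => (Finset.mem_filter.1 hu).2) (fun u hu => hU u (Finset.mem_filter.1 hu).1)
  set S := N.filter fun u => 3 ≤ ∑ t, u t with hS
  have hU4 := card_le_of_divisors_mem S (U.filter fun u => 4 ≤ ∑ t, u t)
    (fun u hu => by have := (Finset.mem_filter.1 hu).2; omega) (by
      intro u hu i v huv
      obtain ⟨huU, h4⟩ := Finset.mem_filter.1 hu
      refine Finset.mem_filter.2 ⟨hU u huU i v huv, ?_⟩
      rw [huv, sum_add_single] at h4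
      omega)
  have hUsplit : U.card ≤ (U.filter fun u => ∑ t, u t = 2).card +
      (U.filter fun u => ∑ t, u t = 3).card + (U.filter fun u => 4 ≤ ∑ t, u t).card := by
    refine (Finset.card_le_card fun u hu => ?_).trans ((Finset.card_union_le _ _).trans
      (Nat.add_le_add_right (Finset.card_union_le _ _) _))
    have hu2 := hUdeg u hu
    simp only [Finset.mem_union, Finset.mem_filter, hu, true_and]
    omega
  have hMsplit : pairCount (quadrics N) + S.card = 6 := by
    have h := Finset.card_filter_add_card_filter_not (s := M) (fun u => ∑ t, u t = 2)
    have h1 : M.filter (fun u => ∑ t, u t = 2) = N.filter fun u => ∑ t, u t = 2 := by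
      ext u
      simp only [hM, Finset.mem_filter, and_assoc, and_congr_right_iff]
      omega
    have h2 : M.filter (fun u => ¬ ∑ t, u t = 2) = S := by
      ext u
      simp only [hM, hS, Finset.mem_filter, and_assoc, and_congr_right_iff]
      omega
    rw [h1, h2, hMcard] at h
    rw [pairCount_quadrics, h]
  have hT := (tripleCount_le (quadrics N) (by omega)).resolve_right hfull
  have hPle : (S.filter IsPurePower).card ≤ S.card := Finset.card_filter_le _ _
  have hPeq : pairCount (quadrics N) ≤ 1 → (S.filter IsPurePower).card = S.card := by
    intro h
    congr 1
    refine Finset.filter_true_of_mem fun u hu => ?_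
    by_contra hup
    obtain ⟨huN, hdeg⟩ := Finset.mem_filter.1 hu
    have := two_le_card_of_not_isPurePower hdown huN hdeg hup
    rw [← pairCount_quadrics] at this
    omega
  have := add_le_nine_of_le hMsplit hT hPle hPeq
  omega

end Corners
section MinimalGenerators

variable {Γ : AddSubmonoid ℕ}

theorem factorizationHom_single (g : minGens Γ) (n : ℕ) :
    factorizationHom Γ (Finsupp.single g n) = g * n := by
  simp [factorizationHom]

theorem factorizationHom_mem (x : minGens Γ →₀ ℕ) : factorizationHom Γ x ∈ Γ := by
  induction x using Finsupp.induction_linear with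
  | zero => simp
  | add x y hx hy => rw [map_add]; exact Γ.add_mem hx hy
  | single g n =>
    rw [factorizationHom_single, mul_comm, ← smul_eq_mul]
    exact Γ.nsmul_mem g.2.1 n

theorem exists_factorizationHom_eq {n : ℕ} (hn : n ∈ Γ) : ∃ x, factorizationHom Γ x = n := by
  induction n using Nat.strong_induction_on with
  | _ n ih =>
    by_cases h0 : n = 0
    · exact ⟨0, by simp [h0]⟩
    · by_cases hg : n ∈ minGens Γ
      · exact ⟨Finsupp.single ⟨n, hg⟩ 1, by simp [factorizationHom_single]⟩
      · have : ∃ a ∈ Γ, ∃ b ∈ Γ, a ≠ 0 ∧ b ≠ 0 ∧ n = a + b := by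
          by_contra! h
          exact hg ⟨hn, h0, h⟩
        obtain ⟨a, ha, b, hb, ha0, hb0, rfl⟩ := this
        obtain ⟨x, hx⟩ := ih a (by omega) ha
        obtain ⟨y, hy⟩ := ih b (by omega) hb
        exact ⟨x + y, by rw [map_add, hx, hy]⟩

theorem exists_eq_add_single {x : minGens Γ →₀ ℕ} (hx : x ≠ 0) :
    ∃ g y, x = y + Finsupp.single g 1 := by
  obtain ⟨g, hg⟩ := Finsupp.ne_iff.1 hx
  refine ⟨g, x - Finsupp.single g 1, (tsub_add_cancel_of_le ?_).symm⟩
  rw [Finsupp.single_le_iff]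
  simpa [Nat.one_le_iff_ne_zero] using hg

theorem eq_single_of_factorizationHom_eq {x : minGens Γ →₀ ℕ} {g : minGens Γ}
    (h : factorizationHom Γ x = g) : x = Finsupp.single g 1 := by
  have h0 : x ≠ 0 := by
    rintro rfl
    exact g.2.2.1 (by simpa using h.symm)
  obtain ⟨k, y, rfl⟩ := exists_eq_add_single h0
  rw [map_add, factorizationHom_single, mul_one] at h
  have hy : y = 0 := by
    by_contra hy
    obtain ⟨l, z, rfl⟩ := exists_eq_add_single hy
    refine g.2.2.2 _ (factorizationHom_mem _) k k.2.1 ?_ k.2.2.1 h.symm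
    rw [map_add, factorizationHom_single, mul_one]
    have := l.2.2.1
    omega
  subst hy
  rw [zero_add, Subtype.ext (show (k : ℕ) = g by simpa using h)]

theorem mult_mem_minGens (h : mult Γ ≠ 0) : mult Γ ∈ minGens Γ := by
  have hne : {g : ℕ | g ∈ Γ ∧ g ≠ 0}.Nonempty := by
    by_contra hne
    exact h (by rw [mult, Set.not_nonempty_iff_eq_empty.1 hne, Nat.sInf_empty])
  have hmin : ∀ a ∈ Γ, a ≠ 0 → mult Γ ≤ a := fun a ha ha0 => Nat.sInf_le ⟨ha, ha0⟩
  refine ⟨(Nat.sInf_mem hne).1, h, fun a ha b hb ha0 hb0 hab => ?_⟩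
  have := hmin a ha ha0
  omega

/-- The residues of `0`, of three elements and of their pairwise sums cannot all be distinct
modulo twelve. -/
theorem not_nodup_sums : ∀ x y z : ZMod 12,
    ¬ [0, x, y, z, x + x, x + y, x + z, y + y, y + z, z + z].Nodup := by
  decide +kernel

theorem nodup_quadratic_monomials : ∀ i j k : Fin 5, i < j → j < k →
    ([0, Pi.single i 1, Pi.single j 1, Pi.single k 1, Pi.single i 1 + Pi.single i 1,
      Pi.single i 1 + Pi.single j 1, Pi.single i 1 + Pi.single k 1, Pi.single j 1 + Pi.single j 1,
      Pi.single j 1 + Pi.single k 1, Pi.single k 1 + Pi.single k 1] : List (Fin 5 → ℕ)).Nodup := by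
  decide +kernel

theorem not_hasFullTriple {N : Finset (Fin 5 → ℕ)} (w : (Fin 5 → ℕ) →+ ℕ) (h0 : 0 ∈ N)
    (hvar : ∀ i, Pi.single i 1 ∈ N)
    (hinj : ∀ a ∈ N, ∀ b ∈ N, (w a : ZMod 12) = w b → a = b) :
    ¬ HasFullTriple (quadrics N) := by
  rintro ⟨i, j, k, hij, hjk, h₁, h₂, h₃, h₄, h₅, h₆⟩
  simp only [quadrics, decide_eq_true_eq] at h₁ h₂ h₃ h₄ h₅ h₆
  have h := List.Nodup.map_on (f := fun a => (w a : ZMod 12)) ?_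
    (nodup_quadratic_monomials i j k hij hjk)
  · simp only [List.map_cons, List.map_nil, map_add, map_zero, Nat.cast_add, Nat.cast_zero] at h
    exact not_nodup_sums _ _ _ h
  · have hN : ∀ a ∈ ([0, Pi.single i 1, Pi.single j 1, Pi.single k 1, Pi.single i 1 + Pi.single i 1,
        Pi.single i 1 + Pi.single j 1, Pi.single i 1 + Pi.single k 1,
        Pi.single j 1 + Pi.single j 1, Pi.single j 1 + Pi.single k 1,
        Pi.single k 1 + Pi.single k 1] : List (Fin 5 → ℕ)), a ∈ N := by
      simp only [List.forall_mem_cons]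
      exact ⟨h0, hvar i, hvar j, hvar k, h₁, h₂, h₃, h₄, h₅, h₆, by simp⟩
    exact fun a ha b hb => hinj a (hN a ha) b (hN b hb)

/-- Every monomial outside a finite order ideal is divisible by one of its corners. -/
theorem exists_finset_corners (N : Finset (Fin 5 → ℕ)) (h0 : 0 ∈ N) :
    ∃ K : Finset (Fin 5 → ℕ), Disjoint K N ∧
      (∀ u ∈ K, ∀ i v, u = v + Pi.single i 1 → v ∈ N) ∧
      ∀ a, a ∉ N → ∃ u ∈ K, u ∉ N ∧ ∃ c, a = u + c := by
  classical
  refine ⟨((N ×ˢ (Finset.univ : Finset (Fin 5))).image fun p => p.1 + Pi.single p.2 1).filter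
    fun u => u ∉ N ∧ ∀ i v, u = v + Pi.single i 1 → v ∈ N, ?_, ?_, ?_⟩
  · exact Finset.disjoint_left.2 fun u hu => (Finset.mem_filter.1 hu).2.1
  · exact fun u hu => (Finset.mem_filter.1 hu).2.2
  · intro a
    induction hd : ∑ t, a t using Nat.strong_induction_on generalizing a with
    | _ d ih =>
      intro ha
      by_cases h : ∀ i v, a = v + Pi.single i 1 → v ∈ N
      · have ha0 : a ≠ 0 := by rintro rfl; exact ha h0
        obtain ⟨i, v, hv⟩ := exists_add_single ha0
        exact ⟨a, Finset.mem_filter.2 ⟨Finset.mem_image.2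
            ⟨(v, i), by simpa using h i v hv, hv.symm⟩,
          ha, h⟩, ha, 0, (add_zero a).symm⟩
      · push Not at h
        obtain ⟨i, v, rfl, hv⟩ := h
        rw [sum_add_single] at hd
        obtain ⟨u, hu, huN, c, rfl⟩ := ih _ (by omega) v rfl hv
        exact ⟨u, hu, huN, c + Pi.single i 1, add_assoc _ _ _⟩

end MinimalGenerators

/-- Every numerical monoid with embedding dimension 6 and multiplicity 12
satisfies ρ(Γ) < 19 = 𝒞(5,12). -/
theorem rho_lt_of_edim6_mult12 (Γ : AddSubmonoid ℕ) (hΓ : IsNumericalMonoid Γ)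
    (hedim : edim Γ = 6) (hmult : mult Γ = 12) :
    rho Γ < 19 := by
  classical
  have h12 : 12 ∈ minGens Γ := hmult ▸ mult_mem_minGens (by omega)
  have hfin : (minGens Γ).Finite := Set.finite_of_ncard_ne_zero (by rw [← edim]; omega)
  have : Finite (minGens Γ) := hfin
  set t : minGens Γ := ⟨12, h12⟩ with ht
  have hcard : Nat.card {x : minGens Γ // x ≠ t} = 5 := by
    have := Set.ncard_add_ncard_compl ({t} : Set (minGens Γ))
    rw [Set.ncard_singleton, Nat.card_coe_set_eq, ← edim, hedim] at this
    exact Nat.add_left_cancel (n := 1) this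
  obtain e : Fin 5 ≃ {x : minGens Γ // x ≠ t} := (Finite.equivFinOfCardEq hcard).symm
  set φ := factorizationHom Γ with hφ
  let ι : (Fin 5 → ℕ) →+ (minGens Γ →₀ ℕ) :=
    ∑ i, (Finsupp.singleAddHom (e i).1).comp (Pi.evalAddMonoidHom (fun _ => ℕ) i)
  have hι : ∀ a, ι a = ∑ i, Finsupp.single (e i).1 (a i) := fun a => by simp [ι]
  have hιt : ∀ a, ι a t = 0 := fun a => by
    rw [hι, Finsupp.finsetSum_apply]
    exact Finset.sum_eq_zero fun i _ => Finsupp.single_eq_of_ne (e i).2.symm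
  have hιe : ∀ a i, ι a (e i).1 = a i := fun a i => by
    rw [hι, Finsupp.finsetSum_apply, Finset.sum_eq_single i]
    · simp
    · intro j _ hj
      exact Finsupp.single_eq_of_ne fun h => hj (e.injective (Subtype.ext h)).symm
    · simp
  have hιinj : Function.Injective ι := fun a b h => by
    ext i; rw [← hιe a, ← hιe b, h]
  have hιsingle : ∀ i, ι (Pi.single i 1) = Finsupp.single (e i).1 1 := fun i => by
    rw [hι, Finset.sum_eq_single i] <;> simp +contextual
  have hφt : φ (Finsupp.single t 1) = 12 := by simp [φ, factorizationHom_single, t]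
  have hsurj : ∀ x, ∃ k : ℕ, ∃ a, x = k • Finsupp.single t 1 + ι a := by
    intro x
    induction x using Finsupp.induction_linear with
    | zero => exact ⟨0, 0, by simp⟩
    | add x y hx hy =>
      obtain ⟨k, a, rfl⟩ := hx
      obtain ⟨l, b, rfl⟩ := hy
      exact ⟨k + l, a + b, by rw [add_smul, map_add]; abel⟩
    | single g n =>
      by_cases hg : g = t
      · exact ⟨n, 0, by simp [hg]⟩
      · refine ⟨0, n • Pi.single (e.symm ⟨g, hg⟩) 1, ?_⟩
        rw [map_nsmul, hιsingle]
        simp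
  let w : (Fin 5 → ℕ) →+ ℕ := φ.comp ι
  let κ : (Fin 5 → ℕ) →+ ℕ ×ₗ Lex (Fin 5 → ℕ) :=
    { toFun := fun a => toLex (w a, toLex a)
      map_zero' := by rw [map_zero]; rfl
      map_add' := fun a b => by rw [map_add]; rfl }
  have hκ : Function.Injective κ := fun a b h => by
    have := congrArg (fun x => (ofLex x).2) h
    exact this
  have hκw : ∀ a b, κ a ≤ κ b → w a ≤ w b := fun a b h => by
    rcases Prod.Lex.toLex_le_toLex.1 h with h | h
    · exact h.le
    · exact h.1.le
  have hres : ∀ a b, IsLeastInResidueClass 12 w κ a → IsLeastInResidueClass 12 w κ b →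
      (w a : ZMod 12) = w b → a = b := fun a b ha hb h =>
    ha.eq_of_modEq hκ hb ((ZMod.natCast_eq_natCast_iff _ _ _).1 h)
  have hNfin : {a | IsLeastInResidueClass 12 w κ a}.Finite :=
    Set.Finite.of_injOn (f := fun a => (w a : ZMod 12)) (t := Set.univ) (fun _ _ => trivial)
      (fun a ha b hb => hres a b ha hb) Set.finite_univ
  set N := hNfin.toFinset with hN
  have hmemN : ∀ a, a ∈ N ↔ IsLeastInResidueClass 12 w κ a := fun a => by simp [hN]
  have hdown : ∀ a b, a + b ∈ N → a ∈ N := fun a b h => by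
    rw [hmemN] at h ⊢
    exact h.of_add
  have hNcard : N.card = 12 := by
    rw [← ZMod.card 12, ← Finset.card_univ]
    refine Finset.card_nbij (fun a => (w a : ZMod 12)) (fun _ _ => Finset.mem_univ _)
      (fun a ha b hb => hres a b ((hmemN a).1 ha) ((hmemN b).1 hb)) fun z _ => ?_
    obtain ⟨B, hB⟩ := hΓ.bddAbove
    have hz : z.val + 12 * (B + 1) ∈ Γ := by
      by_contra h
      have := hB h
      omega
    obtain ⟨x, hx⟩ := exists_factorizationHom_eq hz
    obtain ⟨k, a, rfl⟩ := hsurj x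
    obtain ⟨r, hr, hra⟩ := exists_isLeastInResidueClass 12 w κ a
    refine ⟨r, (hmemN r).2 hr, ?_⟩
    have h1 : k * 12 + w a = z.val + 12 * (B + 1) := by
      rw [← hx, map_add, map_nsmul, ← hφ, hφt]; rfl
    have h2 := congrArg (Nat.cast : ℕ → ZMod 12) h1
    have h12 : (12 : ZMod 12) = 0 := rfl
    simp only [Nat.cast_add, Nat.cast_mul, ZMod.natCast_val, ZMod.cast_id', id, Nat.cast_ofNat,
      h12, mul_zero, zero_mul, zero_add, add_zero] at h2
    rw [← h2]
    exact (ZMod.natCast_eq_natCast_iff _ _ _).2 hra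
  have hvar : ∀ i, Pi.single i 1 ∈ N := by
    intro i
    rw [hmemN]
    intro b hb
    by_contra! hlt
    have hle := hκw _ _ hlt.le
    have hwi : w (Pi.single i 1) = (e i).1 := by
      change φ (ι _) = _
      rw [hιsingle]
      simp [φ, factorizationHom_single]
    obtain ⟨k, hk⟩ := (Nat.modEq_iff_dvd' hle).1 hb
    have h1 : φ (k • Finsupp.single t 1 + ι b) = (e i).1 := by
      rw [map_add, map_nsmul, hφt, ← hwi]
      change k * 12 + w b = _
      omega
    have h2 := eq_single_of_factorizationHom_eq h1
    rw [← hιsingle] at h2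
    have hk0 : k = 0 := by
      have := DFunLike.congr_fun h2 t
      simpa [hιt] using this
    rw [hk0, zero_smul, zero_add] at h2
    exact hlt.ne (congrArg κ (hιinj h2))
  have h0 : 0 ∈ N := hdown 0 (Pi.single 0 1) (by simpa using hvar 0)
  have hfull : ¬ HasFullTriple (quadrics N) := not_hasFullTriple w h0 hvar fun a ha b hb =>
    hres a b ((hmemN a).1 ha) ((hmemN b).1 hb)
  obtain ⟨K, hKN, hK, hKdvd⟩ := exists_finset_corners N h0
  have hKcard := card_corners_le hdown hNcard hvar hfull K hKN hK
  simp only [hmemN] at hKdvd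
  obtain ⟨f, hf⟩ := exists_generating_pairs φ (Finsupp.single t 1) ι hsurj (by norm_num) hφt
    (fun _ => rfl) hκ hκw (K : Set (Fin 5 → ℕ)) hKdvd
  have hle : rho Γ ≤ (f '' (K : Set (Fin 5 → ℕ))).ncard :=
    Nat.sInf_le ⟨_, K.finite_toSet.image f, rfl, hf⟩
  have hle' := Set.ncard_image_le (f := f) K.finite_toSet
  rw [Set.ncard_coe_finset] at hle'
  omega
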